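/- Let K be a field of characteristic zero, let V be a finite-dimensional K-vector space with dim V = 2n, and let ω be an element of Λ²(V*) whose associated alternating bilinear form on V is nondegenerate. Then for every natural number k: (a) if k ≤ n − 1, the linear map Λ^k(V*) → Λ^{k+2}(V*), α ↦ ω ∧ α, is injective; and (b) if n − 1 ≤ k ≤ 2n − 2, the linear map Λ^k(V*) → Λ^{k+2}(V*), α ↦ ω ∧ α, is surjective. -/

import Mathlib

open ExteriorAlgebra

/-- The alternating bilinear form on `V` associated to an element
`ω ∈ Λ²(V*)` of the second exterior power of the dual space, obtained via the
canonical pairing: `B(v, w)` is the scalar part of the double interior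
contraction of `ω` by (the double-dual images of) `v` and `w`. -/
noncomputable def ExteriorSquareDual.assocForm (K V : Type*) [Field K] [AddCommGroup V]
    [Module K V] (ω : ExteriorAlgebra K (Module.Dual K V)) (v w : V) : K :=
  ExteriorAlgebra.algebraMapInv
    (CliffordAlgebra.contractLeft (Module.Dual.eval K V v)
      (CliffordAlgebra.contractLeft (Module.Dual.eval K V w) ω))

/-- If a raising operator `L` and a lowering operator `D` of degrees `2` and `-2` satisfy
`[D, L] = 2 (n - k)` in degree `k`, then `L * D + c` is injective in degrees `k < n` for every
positive integer `c`. -/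
lemma eq_zero_of_raise_lower_eq_neg_smul {K A : Type*} [Field K] [CharZero K] [AddCommGroup A]
    [Module K A] (G : ℕ → Submodule K A) (L D : A →ₗ[K] A) (n : ℕ)
    (hD : ∀ k, ∀ x ∈ G (k + 2), D x ∈ G k)
    (hD0 : ∀ x ∈ G 0, D x = 0) (hD1 : ∀ x ∈ G 1, D x = 0)
    (hcomm : ∀ k, ∀ x ∈ G k, D (L x) = L (D x) + (2 * (n : K) - 2 * (k : K)) • x)
    (k : ℕ) (hk : k < n) (x : A) (hx : x ∈ G k) (c : ℕ) (hc : 0 < c)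
    (h : L (D x) = -((c : K) • x)) : x = 0 := by
  have hcK : (c : K) ≠ 0 := by exact_mod_cast hc.ne'
  suffices hDx : D x = 0 by
    rw [hDx, map_zero, zero_eq_neg] at h
    exact (smul_eq_zero.mp h).resolve_left hcK
  induction k using Nat.twoStepInduction generalizing x c with
  | zero => exact hD0 x hx
  | one => exact hD1 x hx
  | more k ih _ =>
    obtain ⟨j, rfl⟩ := Nat.exists_eq_add_of_lt hk
    have hy := hD k x hx
    have hcm := hcomm k (D x) hy
    rw [h, map_neg, map_smul] at hcm
    have hc' : ((c + 2 * (j + 3) : ℕ) : K) ≠ 0 := Nat.cast_ne_zero.mpr (by omega)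
    have h' : L (D (D x)) = -(((c + 2 * (j + 3) : ℕ) : K) • D x) := by
      rw [← sub_eq_iff_eq_add] at hcm
      rw [← hcm]
      push_cast
      module
    have hDDx := ih (by omega) (D x) hy (c + 2 * (j + 3)) (by omega) h' hc'
    rw [hDDx, map_zero, zero_eq_neg] at h'
    exact (smul_eq_zero.mp h').resolve_left hc'

/-- If a raising operator `L` and a lowering operator `D` of degrees `2` and `-2` satisfy
`[D, L] = 2 (n - k)` in degree `k`, and high degrees vanish, then `D * L + c` is surjective in
degrees `m > n - 2` for every positive integer `c`. -/
lemma exists_lower_raise_add_smul_eq {K A : Type*} [Field K] [CharZero K] [AddCommGroup A]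
    [Module K A] (G : ℕ → Submodule K A) (L D : A →ₗ[K] A) (n N : ℕ)
    (hL : ∀ k, ∀ x ∈ G k, L x ∈ G (k + 2))
    (hD : ∀ k, ∀ x ∈ G (k + 2), D x ∈ G k)
    (hG : ∀ k, N < k → G k = ⊥)
    (hcomm : ∀ k, ∀ x ∈ G k, D (L x) = L (D x) + (2 * (n : K) - 2 * (k : K)) • x)
    (r m : ℕ) (hm : n < m + 2) (hr : N < m + r) (x : A) (hx : x ∈ G m) (c : ℕ) (hc : 0 < c) :
    ∃ z ∈ G m, D (L z) + (c : K) • z = x := by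
  induction r generalizing m x c with
  | zero =>
    rw [hG m (by omega), Submodule.mem_bot] at hx
    exact ⟨0, zero_mem _, by simp [hx]⟩
  | succ r ih =>
    obtain ⟨j, hj⟩ := Nat.exists_eq_add_of_lt hm
    have hcK : (c : K) ≠ 0 := by exact_mod_cast hc.ne'
    obtain ⟨y, hy, hyx⟩ := ih (m + 2) (by omega) (by omega) (L x) (hL m x hx)
      (c + 2 * (j + 1)) (by omega)
    refine ⟨(c : K)⁻¹ • (x - D y), Submodule.smul_mem _ _ (sub_mem hx (hD m y hy)), ?_⟩
    have hLDy : L (D y) = L x - (c : K) • y := by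
      have hcm := hcomm (m + 2) y hy
      rw [hj, ← sub_eq_iff_eq_add] at hcm
      rw [← hcm, ← hyx]
      push_cast
      module
    rw [map_smul, map_sub, hLDy, sub_sub_cancel, smul_inv_smul₀ hcK, map_smul, map_smul,
      inv_smul_smul₀ hcK, add_sub_cancel]

namespace ExteriorAlgebra

open CliffordAlgebra (contractLeft contractLeft_ι_mul contractLeft_ι contractLeft_algebraMap)

variable {K W : Type*} [Field K] [AddCommGroup W] [Module K W]

lemma contractLeft_eq_zero_of_mem_exteriorPower_zero (d : Module.Dual K W)
    {x : ExteriorAlgebra K W} (hx : x ∈ ⋀[K]^0 W) : contractLeft d x = 0 := by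
  rw [exteriorPower, pow_zero, Submodule.mem_one] at hx
  obtain ⟨r, rfl⟩ := hx
  exact contractLeft_algebraMap _ d r

lemma contractLeft_mem_exteriorPower (d : Module.Dual K W) (k : ℕ) {x : ExteriorAlgebra K W}
    (hx : x ∈ ⋀[K]^(k + 1) W) : contractLeft d x ∈ ⋀[K]^k W := by
  induction k generalizing x with
  | zero =>
    rw [exteriorPower, zero_add, pow_one] at hx
    obtain ⟨a, rfl⟩ := hx
    rw [exteriorPower, pow_zero, contractLeft_ι]
    exact Submodule.algebraMap_mem _
  | succ k ih =>
    rw [exteriorPower, pow_succ'] at hx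
    induction hx using Submodule.mul_induction_on' with
    | add x _ y _ hx hy => rw [map_add]; exact add_mem hx hy
    | mem_mul_mem a ha y hy =>
      obtain ⟨a, rfl⟩ := ha
      rw [contractLeft_ι_mul]
      refine sub_mem (Submodule.smul_mem _ _ hy) ?_
      rw [exteriorPower, pow_succ']
      exact Submodule.mul_mem_mul ⟨a, rfl⟩ (ih hy)

/-- The Euler operator of the exterior algebra, written in terms of dual families. -/
lemma sum_ι_mul_contractLeft {I : Type*} [Fintype I] (a : I → W) (d : I → Module.Dual K W)
    (h : ∀ w, ∑ i, d i w • a i = w) (k : ℕ) {x : ExteriorAlgebra K W} (hx : x ∈ ⋀[K]^k W) :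
    ∑ i, ι K (a i) * contractLeft (d i) x = (k : K) • x := by
  induction k generalizing x with
  | zero => simp [contractLeft_eq_zero_of_mem_exteriorPower_zero _ hx]
  | succ k ih =>
    rw [exteriorPower, pow_succ'] at hx
    induction hx using Submodule.mul_induction_on' with
    | add x _ y _ hx hy => simp only [map_add, mul_add, Finset.sum_add_distrib, hx, hy, smul_add]
    | mem_mul_mem b hb y hy =>
      obtain ⟨b, rfl⟩ := hb
      have hswap (i : I) : ι K (a i) * contractLeft (d i) (ι K b * y) =
          ι K (d i b • a i) * y + ι K b * (ι K (a i) * contractLeft (d i) y) := by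
        have hanti : ι K (a i) * ι K b = -(ι K b * ι K (a i)) :=
          eq_neg_of_add_eq_zero_left (ι_add_mul_swap (a i) b)
        rw [contractLeft_ι_mul, mul_sub, ← mul_assoc, hanti, mul_smul_comm, map_smul,
          smul_mul_assoc, neg_mul, sub_neg_eq_add, mul_assoc]
      simp_rw [hswap]
      rw [Finset.sum_add_distrib, ← Finset.sum_mul, ← map_sum, h, ← Finset.mul_sum, ih hy,
        mul_smul_comm]
      push_cast
      module

/-- Interior contraction of an element of the second exterior power is a skew-symmetric map, and
contraction is a derivation against multiplication by such an element. -/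
lemma exists_contractLeft_mul_eq {ω : ExteriorAlgebra K W} (hω : ω ∈ ⋀[K]^2 W) :
    ∃ φ : Module.Dual K W →ₗ[K] W, (∀ d e : Module.Dual K W, e (φ d) = -d (φ e)) ∧
      (∀ d, contractLeft d ω = ι K (φ d)) ∧
      ∀ d x, contractLeft d (ω * x) = ι K (φ d) * x + ω * contractLeft d x := by
  rw [exteriorPower, pow_two] at hω
  induction hω using Submodule.mul_induction_on' with
  | add ω _ η _ hω hη =>
    obtain ⟨φ, hφ, hφω, hφx⟩ := hω
    obtain ⟨ψ, hψ, hψη, hψx⟩ := hη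
    refine ⟨φ + ψ, fun d e => ?_, fun d => ?_, fun d x => ?_⟩
    · simp only [LinearMap.add_apply, map_add, hφ d e, hψ d e, neg_add]
    · simp only [LinearMap.add_apply, map_add, hφω, hψη]
    · simp only [LinearMap.add_apply, map_add, add_mul, hφx, hψx]
      abel
  | mem_mul_mem a ha b hb =>
    obtain ⟨a, rfl⟩ := ha
    obtain ⟨b, rfl⟩ := hb
    refine ⟨(LinearMap.applyₗ a).smulRight b - (LinearMap.applyₗ b).smulRight a, fun d e => ?_,
      fun d => ?_, fun d x => ?_⟩
    · simp only [LinearMap.sub_apply, LinearMap.smulRight_apply, LinearMap.applyₗ_apply_apply,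
        map_sub, map_smul, smul_eq_mul]
      ring
    · rw [contractLeft_ι_mul, contractLeft_ι, ← Algebra.commutes, ← Algebra.smul_def]
      simp
    · rw [mul_assoc, contractLeft_ι_mul, contractLeft_ι_mul]
      simp only [LinearMap.sub_apply, LinearMap.smulRight_apply, LinearMap.applyₗ_apply_apply,
        map_sub, map_smul, sub_mul, mul_sub, smul_mul_assoc, mul_smul_comm, mul_assoc]
      abel

lemma exteriorPower_eq_bot_of_finrank_lt [FiniteDimensional K W] {k : ℕ}
    (hk : Module.finrank K W < k) : ⋀[K]^k W = ⊥ := by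
  rw [← Submodule.finrank_eq_zero (R := K), exteriorPower.finrank_eq, Nat.choose_eq_zero_of_lt hk]

/-- The lowering operator `∑ i, ι_{d i} ∘ ι_{e i}` on the exterior algebra. -/
noncomputable def lower {I : Type*} [Fintype I] (d e : I → Module.Dual K W) :
    ExteriorAlgebra K W →ₗ[K] ExteriorAlgebra K W :=
  ∑ i, contractLeft (d i) ∘ₗ contractLeft (e i)

lemma lower_apply {I : Type*} [Fintype I] (d e : I → Module.Dual K W)
    (x : ExteriorAlgebra K W) :
    lower d e x = ∑ i, contractLeft (d i) (contractLeft (e i) x) := by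
  simp [lower]

/-- The commutation relation between multiplication by `ω` and the dual lowering operator. -/
lemma lower_mul_eq {I : Type*} [Fintype I] (d e : I → Module.Dual K W)
    {ω : ExteriorAlgebra K W} (φ : Module.Dual K W →ₗ[K] W)
    (hφω : ∀ d x, contractLeft d (ω * x) = ι K (φ d) * x + ω * contractLeft d x)
    (h₁ : ∀ w, ∑ i, d i w • φ (e i) = w) (h₂ : ∀ w, ∑ i, e i w • φ (d i) = -w)
    (htrace : ∑ i, d i (φ (e i)) = Fintype.card I)
    (k : ℕ) {x : ExteriorAlgebra K W} (hx : x ∈ ⋀[K]^k W) :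
    lower d e (ω * x) = ω * lower d e x + ((Fintype.card I : K) - 2 * (k : K)) • x := by
  have hterm (i : I) : contractLeft (d i) (contractLeft (e i) (ω * x)) =
      d i (φ (e i)) • x - ι K (φ (e i)) * contractLeft (d i) x
        - ι K (-φ (d i)) * contractLeft (e i) x
        + ω * contractLeft (d i) (contractLeft (e i) x) := by
    rw [hφω, map_add, contractLeft_ι_mul, hφω, map_neg, neg_mul]
    abel
  have h₂' : ∀ w, ∑ i, e i w • -φ (d i) = w := fun w => by
    simp only [smul_neg, Finset.sum_neg_distrib, h₂, neg_neg]
  simp_rw [lower_apply, hterm]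
  rw [Finset.sum_add_distrib, Finset.sum_sub_distrib, Finset.sum_sub_distrib, ← Finset.sum_smul,
    htrace, sum_ι_mul_contractLeft _ _ h₁ k hx, sum_ι_mul_contractLeft _ _ h₂' k hx,
    Finset.mul_sum]
  module

/-- A nondegenerate element of the second exterior power has a dual lowering operator. -/
lemma exists_lower_mul_eq {V : Type*} [AddCommGroup V] [Module K V] [FiniteDimensional K V]
    {ω : ExteriorAlgebra K (Module.Dual K V)} (hω : ω ∈ ⋀[K]^2 (Module.Dual K V))
    (hnd : ∀ v : V, (∀ w : V, ExteriorSquareDual.assocForm K V ω v w = 0) → v = 0) :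
    ∃ d e : Fin (Module.finrank K V) → Module.Dual K (Module.Dual K V),
      ∀ k, ∀ x ∈ ⋀[K]^k (Module.Dual K V), lower d e (ω * x) =
        ω * lower d e x + ((Module.finrank K V : K) - 2 * (k : K)) • x := by
  obtain ⟨φ, hskew, hφω, hφx⟩ := exists_contractLeft_mul_eq hω
  let ψ : V →ₗ[K] Module.Dual K V := φ ∘ₗ Module.Dual.eval K V
  have hψ (v w : V) : ψ v w = -ψ w v := hskew (Module.Dual.eval K V v) (Module.Dual.eval K V w)
  have hform (v w : V) : ExteriorSquareDual.assocForm K V ω v w = ψ w v := by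
    rw [ExteriorSquareDual.assocForm, hφω, contractLeft_ι]
    exact algebraMap_leftInverse _ _
  have hinj : Function.Injective ψ := by
    rw [injective_iff_map_eq_zero]
    intro v hv
    refine hnd v fun w => ?_
    rw [hform, hψ, hv, LinearMap.zero_apply, neg_zero]
  have hsurj : Function.Surjective ψ :=
    (LinearMap.injective_iff_surjective_of_finrank_eq_finrank
      Subspace.dual_finrank_eq.symm).mp hinj
  let b := Module.finBasis K V
  choose f hf using fun i => hsurj (b.coord i)
  have h₁ (w : Module.Dual K V) : ∑ i, w (b i) • b.coord i = w := b.sum_dual_apply_smul_coord w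
  refine ⟨fun i => Module.Dual.eval K V (b i), fun i => Module.Dual.eval K V (f i),
    fun k x hx => ?_⟩
  have key := lower_mul_eq (fun i => Module.Dual.eval K V (b i))
    (fun i => Module.Dual.eval K V (f i)) φ hφx (fun w => ?_) (fun w => ?_) ?_ k hx
  · rwa [Fintype.card_fin] at key
  · change ∑ i, w (b i) • ψ (f i) = w
    simp_rw [hf]
    exact h₁ w
  · change ∑ i, w (f i) • ψ (b i) = -w
    obtain ⟨u, rfl⟩ := hsurj w
    have hu (i) : ψ u (f i) • ψ (b i) = -ψ (b.coord i u • b i) := by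
      rw [hψ, hf, map_smul]
      exact neg_smul (b.coord i u) (ψ (b i))
    simp_rw [hu]
    rw [Finset.sum_neg_distrib, ← map_sum, show ∑ i, b.coord i u • b i = u from b.sum_repr u]
  · change ∑ i, ψ (f i) (b i) = _
    simp [hf]

end ExteriorAlgebra

set_option synthInstance.maxHeartbeats 1000000 in
/-- Let `dim V = 2n` over a field of characteristic zero and let `ω ∈ Λ²(V*)`
have nondegenerate associated alternating bilinear form.  Then for every `k`:
(a) if `k ≤ n - 1`, the linear map `Λ^k(V*) → Λ^{k+2}(V*)`, `α ↦ ω ∧ α`, is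
injective; (b) if `n - 1 ≤ k ≤ 2n - 2`, this linear map is surjective. -/
theorem wedge_omega_injective_surjective (K V : Type*) [Field K] [CharZero K] [AddCommGroup V]
    [Module K V] [FiniteDimensional K V] (n : ℕ) (hdim : Module.finrank K V = 2 * n)
    (ω : ExteriorAlgebra K (Module.Dual K V)) (hω : ω ∈ ⋀[K]^2 (Module.Dual K V))
    (hnd : ∀ v : V, (∀ w : V, ExteriorSquareDual.assocForm K V ω v w = 0) → v = 0)
    (k : ℕ) :
    (k + 1 ≤ n →
      ∃ f : (⋀[K]^k (Module.Dual K V)) →ₗ[K] (⋀[K]^(k + 2) (Module.Dual K V)),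
        (∀ α : ⋀[K]^k (Module.Dual K V),
            (f α : ExteriorAlgebra K (Module.Dual K V)) =
              ω * (α : ExteriorAlgebra K (Module.Dual K V))) ∧
        Function.Injective f) ∧
    (n ≤ k + 1 → k + 2 ≤ 2 * n →
      ∃ f : (⋀[K]^k (Module.Dual K V)) →ₗ[K] (⋀[K]^(k + 2) (Module.Dual K V)),
        (∀ α : ⋀[K]^k (Module.Dual K V),
            (f α : ExteriorAlgebra K (Module.Dual K V)) =
              ω * (α : ExteriorAlgebra K (Module.Dual K V))) ∧
        Function.Surjective f) := by
  obtain ⟨d, e, hde⟩ := ExteriorAlgebra.exists_lower_mul_eq hω hnd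
  have hcomm : ∀ k, ∀ x ∈ ⋀[K]^k (Module.Dual K V),
      lower d e (LinearMap.mulLeft K ω x) =
        LinearMap.mulLeft K ω (lower d e x) + (2 * (n : K) - 2 * (k : K)) • x := by
    intro k x hx
    have := hde k x hx
    have hdimK : (Module.finrank K V : K) = 2 * n := by exact_mod_cast hdim
    rwa [hdimK] at this
  have hL : ∀ k, ∀ x ∈ ⋀[K]^k (Module.Dual K V),
      LinearMap.mulLeft K ω x ∈ ⋀[K]^(k + 2) (Module.Dual K V) := by
    intro k x hx
    rw [add_comm, exteriorPower, pow_add]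
    exact Submodule.mul_mem_mul hω hx
  have hD : ∀ k, ∀ x ∈ ⋀[K]^(k + 2) (Module.Dual K V),
      lower d e x ∈ ⋀[K]^k (Module.Dual K V) := by
    intro k x hx
    rw [lower_apply]
    exact Submodule.sum_mem _ fun i _ => contractLeft_mem_exteriorPower _ _
      (contractLeft_mem_exteriorPower _ _ hx)
  have hf (α : ⋀[K]^k (Module.Dual K V)) :
      ((LinearMap.mulLeft K ω).restrict (hL k) α : ExteriorAlgebra K (Module.Dual K V)) =
        ω * (α : ExteriorAlgebra K (Module.Dual K V)) := rfl
  refine ⟨fun hk => ⟨(LinearMap.mulLeft K ω).restrict (hL k), hf, ?_⟩,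
    fun hk _ => ⟨(LinearMap.mulLeft K ω).restrict (hL k), hf, ?_⟩⟩
  · rw [injective_iff_map_eq_zero]
    intro α hα
    have hωα : LinearMap.mulLeft K ω (α : ExteriorAlgebra K (Module.Dual K V)) = 0 :=
      congrArg Subtype.val hα
    have h := hcomm k α α.2
    obtain ⟨j, hj⟩ := Nat.exists_eq_add_of_le hk
    refine Subtype.ext (eq_zero_of_raise_lower_eq_neg_smul (fun k => ⋀[K]^k (Module.Dual K V))
      (LinearMap.mulLeft K ω) (lower d e) n hD (fun x hx => ?_) (fun x hx => ?_) hcomm k hk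
      α α.2 (2 * (j + 1)) (by omega) ?_)
    · simp [lower_apply, contractLeft_eq_zero_of_mem_exteriorPower_zero _ hx]
    · rw [lower_apply]
      exact Finset.sum_eq_zero fun i _ => contractLeft_eq_zero_of_mem_exteriorPower_zero _
        (contractLeft_mem_exteriorPower _ 0 hx)
    · rw [hωα, map_zero, hj] at h
      rw [eq_neg_of_add_eq_zero_left h.symm]
      push_cast
      module
  · rintro ⟨β, hβ⟩
    obtain ⟨j, hj⟩ := Nat.exists_eq_add_of_le hk
    obtain ⟨z, hz, hzβ⟩ := exists_lower_raise_add_smul_eq (fun k => ⋀[K]^k (Module.Dual K V))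
      (LinearMap.mulLeft K ω) (lower d e) n (2 * n) hL hD
      (fun k hk => exteriorPower_eq_bot_of_finrank_lt
        (by rwa [Subspace.dual_finrank_eq, hdim])) hcomm (2 * n) (k + 2) (by omega) (by omega)
      β hβ (2 * (j + 1)) (by omega)
    refine ⟨⟨lower d e z, hD k z hz⟩, Subtype.ext ?_⟩
    change LinearMap.mulLeft K ω (lower d e z) = β
    have hkK : (k : K) + 1 = n + j := by exact_mod_cast hj
    have hcoef : 2 * (n : K) - 2 * ((k + 2 : ℕ) : K) = -((2 * (j + 1) : ℕ) : K) := by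
      push_cast
      linear_combination -2 * hkK
    rw [← hzβ, hcomm (k + 2) z hz, hcoef, neg_smul, neg_add_cancel_right]
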